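/- arXiv:2407.18688 — 5 statements merged into one kernel-verified Lean document; each statement's English description precedes it below -/
import Mathlib

section
/- Let n ≥ 3 and let 1 ≤ j ≤ n−1 be an integer. Then for every p ∈ [(j−1)/(n−1), j/(n−1)], M(n,2,p) = (1/C(n−j+1,2)) · ( C(n,2)·p² − n(j−1)·p + C(j,2) ), where C(a,b) denotes the binomial coefficient. -/
open scoped BigOperators

noncomputable section

/-- The probability, under the mass function `f` on `{0,1}^n`, of the event that
all coordinates in `S` equal `1` (i.e. `true`). -/
def prAll {n : ℕ} (f : (Fin n → Bool) → ℝ) (S : Finset (Fin n)) : ℝ :=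
  ∑ x ∈ Finset.univ.filter (fun x : Fin n → Bool => ∀ i ∈ S, x i = true), f x

/-- `f` is the mass function of a probability measure on `{0,1}^n` making the
coordinate random variables `k`-wise independent Bernoulli(`p`) bits:
`P(X_{i₁} = ⋯ = X_{i_s} = 1) = p ^ s` for all `1 ≤ s ≤ k`. -/
def memA (n k : ℕ) (p : ℝ) (f : (Fin n → Bool) → ℝ) : Prop :=
  (∀ x, 0 ≤ f x) ∧ (∑ x, f x) = 1 ∧
    ∀ S : Finset (Fin n), 1 ≤ S.card → S.card ≤ k → prAll f S = p ^ S.card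

/-- `M n k p`: the maximum of `P(X₁ = ⋯ = Xₙ = 1)` over `A(n,k,p)`. -/
def M (n k : ℕ) (p : ℝ) : ℝ :=
  sSup {y : ℝ | ∃ f, memA n k p f ∧ prAll f Finset.univ = y}

/-- Bonferroni polynomial `B(m,l,x) = Σ_{i=0}^{l} (−1)^i C(m,i) x^i`;
by convention it is `0` for negative `l`. -/
def bonf (m : ℕ) (l : ℤ) (x : ℝ) : ℝ :=
  if l < 0 then 0
  else ∑ i ∈ Finset.range (l.toNat + 1), (-1 : ℝ) ^ i * (m.choose i) * x ^ i

/-- The number of coordinates of `x` equal to `true`. -/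
def ones {n : ℕ} (x : Fin n → Bool) : ℕ :=
  (Finset.univ.filter (fun i => x i = true)).card

/-- The mass function of the uniform distribution on the vectors with exactly `k` ones. -/
def level (n k : ℕ) (x : Fin n → Bool) : ℝ :=
  if ones x = k then ((n.choose k : ℕ) : ℝ)⁻¹ else 0

lemma card_superset_powersetCard {α : Type*} [Fintype α] [DecidableEq α] (S : Finset α) (k : ℕ)
    (hk : S.card ≤ k) :
    (Finset.univ.filter (fun T : Finset α => T.card = k ∧ S ⊆ T)).card
      = (Fintype.card α - S.card).choose (k - S.card) := by
  rw [← Finset.card_compl, ← Finset.card_powersetCard]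
  refine Finset.card_nbij' (fun T => T \ S) (fun T => T ∪ S) ?_ ?_ ?_ ?_
  · intro T hT
    simp only [Finset.coe_filter, Finset.mem_univ, true_and, Set.mem_ofPred_eq] at hT
    simp only [Finset.mem_coe, Finset.mem_powersetCard]
    refine ⟨fun i hi => by simp at hi ⊢; exact hi.2, ?_⟩
    rw [Finset.card_sdiff_of_subset hT.2, hT.1]
  · intro T hT
    simp only [Finset.mem_coe, Finset.mem_powersetCard] at hT
    simp only [Finset.coe_filter, Finset.mem_univ, true_and, Set.mem_ofPred_eq]
    refine ⟨?_, Finset.subset_union_right⟩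
    rw [Finset.card_union_of_disjoint, hT.2]
    · omega
    · exact Finset.disjoint_left.2 fun i hi => Finset.mem_compl.1 (hT.1 hi)
  · intro T hT
    simp only [Finset.coe_filter, Finset.mem_univ, true_and, Set.mem_ofPred_eq] at hT
    exact Finset.sdiff_union_of_subset hT.2
  · intro T hT
    simp only [Finset.mem_coe, Finset.mem_powersetCard] at hT
    exact Finset.union_sdiff_cancel_right
      (Finset.disjoint_left.2 fun i hi => Finset.mem_compl.1 (hT.1 hi))

lemma card_ones_eq_of_forall_mem {n : ℕ} (S : Finset (Fin n)) (k : ℕ) :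
    (Finset.univ.filter (fun x : Fin n → Bool => (∀ i ∈ S, x i = true) ∧ ones x = k)).card
      = (Finset.univ.filter (fun T : Finset (Fin n) => T.card = k ∧ S ⊆ T)).card := by
  refine Finset.card_nbij' (fun x => Finset.univ.filter (fun i => x i = true))
    (fun T i => decide (i ∈ T)) ?_ ?_ ?_ ?_
  · intro x hx
    simp only [Finset.coe_filter, Finset.mem_univ, true_and, Set.mem_ofPred_eq] at hx ⊢
    exact ⟨hx.2, fun i hi => by simp [hx.1 i hi]⟩
  · intro T hT
    simp only [Finset.coe_filter, Finset.mem_univ, true_and, Set.mem_ofPred_eq] at hT ⊢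
    exact ⟨fun i hi => by simpa using hT.2 hi, by simpa [ones] using hT.1⟩
  · intro x _
    ext i
    simp
  · intro T _
    ext i
    simp

lemma prAll_level_mul_choose {n k : ℕ} (hk : k ≤ n) (S : Finset (Fin n)) :
    prAll (level n k) S * (n.choose S.card : ℝ) = (k.choose S.card : ℝ) := by
  have hsum : prAll (level n k) S =
      (Finset.univ.filter (fun T : Finset (Fin n) => T.card = k ∧ S ⊆ T)).card
        * ((n.choose k : ℕ) : ℝ)⁻¹ := by
    rw [← card_ones_eq_of_forall_mem]
    simp only [prAll, level]
    rw [← Finset.sum_filter, Finset.filter_filter, Finset.sum_const, nsmul_eq_mul]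
  have hpos : ((n.choose k : ℕ) : ℝ) ≠ 0 := by
    exact_mod_cast (Nat.choose_pos hk).ne'
  rcases le_or_gt S.card k with hs | hs
  · rw [hsum, card_superset_powersetCard S k hs, Fintype.card_fin]
    have h : (n.choose k : ℝ) * (k.choose S.card : ℝ)
        = (n.choose S.card : ℝ) * ((n - S.card).choose (k - S.card) : ℝ) := by
      exact_mod_cast Nat.choose_mul hs
    field_simp
    linarith
  · have hempty : Finset.univ.filter (fun T : Finset (Fin n) => T.card = k ∧ S ⊆ T) = ∅ := by
      refine Finset.filter_eq_empty_iff.2 fun T _ hT => ?_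
      have := Finset.card_le_card hT.2
      omega
    rw [hsum, hempty, Nat.choose_eq_zero_of_lt hs]
    simp

lemma sum_mul_ones {n : ℕ} (f : (Fin n → Bool) → ℝ) :
    ∑ x, f x * (ones x : ℝ) = ∑ i, prAll f {i} := by
  simp only [prAll, Finset.mem_singleton, forall_eq, Finset.sum_filter]
  rw [Finset.sum_comm]
  refine Finset.sum_congr rfl fun x _ => ?_
  simp [ones, ← Finset.sum_filter, mul_comm]

lemma sum_mul_ones_sq {n : ℕ} (f : (Fin n → Bool) → ℝ) :
    ∑ x, f x * (ones x : ℝ) ^ 2 = ∑ i, ∑ k, prAll f {i, k} := by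
  have h : ∀ i, ∑ k, prAll f {i, k}
      = ∑ x, if x i = true then f x * (ones x : ℝ) else 0 := by
    intro i
    simp only [prAll, Finset.sum_filter]
    rw [Finset.sum_comm]
    refine Finset.sum_congr rfl fun x _ => ?_
    by_cases hx : x i = true
    · simp [hx, ones, ← Finset.sum_filter, mul_comm]
    · simp [hx]
  simp only [h]
  rw [Finset.sum_comm]
  refine Finset.sum_congr rfl fun x _ => ?_
  rw [← Finset.sum_filter, Finset.sum_const, nsmul_eq_mul]
  simp only [ones]
  ring

lemma memA.sum_mul_ones {n : ℕ} {p : ℝ} {f : (Fin n → Bool) → ℝ} (hf : memA n 2 p f) :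
    ∑ x, f x * (ones x : ℝ) = n * p := by
  rw [_root_.sum_mul_ones]
  have h : ∀ i, prAll f {i} = p := fun i => by
    simpa using hf.2.2 {i} (by simp) (by simp)
  simp [h]

lemma memA.sum_mul_ones_sq {n : ℕ} {p : ℝ} {f : (Fin n → Bool) → ℝ} (hf : memA n 2 p f) :
    ∑ x, f x * (ones x : ℝ) ^ 2 = n * (n - 1) * p ^ 2 + n * p := by
  rw [_root_.sum_mul_ones_sq]
  have h : ∀ i k, prAll f {i, k} = p ^ 2 + if i = k then p - p ^ 2 else 0 := by
    intro i k
    by_cases hik : i = k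
    · subst hik
      simpa using hf.2.2 {i} (by simp) (by simp)
    · have hc : ({i, k} : Finset (Fin n)).card = 2 := Finset.card_pair hik
      rw [hf.2.2 {i, k} (by omega) (by omega), hc]
      simp [hik]
  simp only [h, Finset.sum_add_distrib, Finset.sum_ite_eq, Finset.mem_univ, if_true,
    Finset.sum_const, Finset.card_univ, Fintype.card_fin, nsmul_eq_mul]
  ring

lemma memA.sum_mul_quadratic {n : ℕ} {p : ℝ} {f : (Fin n → Bool) → ℝ} (hf : memA n 2 p f)
    (j : ℝ) :
    ∑ x, f x * (((ones x : ℝ) - (j - 1)) * ((ones x : ℝ) - j))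
      = n * (n - 1) * p ^ 2 - 2 * n * (j - 1) * p + j * (j - 1) := by
  have h : ∀ x, f x * (((ones x : ℝ) - (j - 1)) * ((ones x : ℝ) - j))
      = f x * (ones x : ℝ) ^ 2 - (2 * j - 1) * (f x * (ones x : ℝ)) + j * (j - 1) * f x :=
    fun x => by ring
  simp only [h, Finset.sum_add_distrib, Finset.sum_sub_distrib, ← Finset.mul_sum,
    hf.sum_mul_ones, hf.sum_mul_ones_sq, hf.2.1]
  ring

lemma prAll_univ {n : ℕ} (f : (Fin n → Bool) → ℝ) :
    prAll f Finset.univ = f fun _ => true := by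
  have h : Finset.univ.filter (fun x : Fin n → Bool => ∀ i ∈ Finset.univ, x i = true)
      = {fun _ => true} := by
    ext x
    simp [funext_iff]
  rw [prAll, h, Finset.sum_singleton]

lemma prAll_empty {n : ℕ} (f : (Fin n → Bool) → ℝ) : prAll f ∅ = ∑ x, f x := by
  simp [prAll]

lemma memA.prAll_univ_mul_le {n : ℕ} {p : ℝ} {f : (Fin n → Bool) → ℝ} (hf : memA n 2 p f)
    (j : ℕ) :
    prAll f Finset.univ * (((n : ℝ) - (j - 1)) * (n - j))
      ≤ n * (n - 1) * p ^ 2 - 2 * n * (j - 1) * p + j * (j - 1) := by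
  rw [← hf.sum_mul_quadratic j, prAll_univ]
  have hnonneg : ∀ x ∈ Finset.univ,
      0 ≤ f x * (((ones x : ℝ) - (j - 1)) * ((ones x : ℝ) - j)) := by
    intro x _
    refine mul_nonneg (hf.1 x) ?_
    rcases lt_or_ge (ones x) j with h | h
    · have h' : (ones x : ℝ) + 1 ≤ j := by exact_mod_cast h
      exact mul_nonneg_of_nonpos_of_nonpos (by linarith) (by linarith)
    · have h' : (j : ℝ) ≤ ones x := by exact_mod_cast h
      exact mul_nonneg (by linarith) (by linarith)
  simpa [ones] using
    Finset.single_le_sum hnonneg (Finset.mem_univ (fun _ : Fin n => true))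

/-- Mixing the levels `j - 1`, `j` and `n` so that the first two moments are those of independent
bits attains the bound of `memA.prAll_univ_mul_le`. -/
lemma exists_memA_prAll_univ_eq {n j : ℕ} (hj1 : 1 ≤ j) (hjn : j < n) {p : ℝ}
    (hp0 : (j : ℝ) - 1 ≤ (n - 1) * p) (hp1 : (n - 1) * p ≤ (j : ℝ)) :
    ∃ f, memA n 2 p f ∧ prAll f Finset.univ =
      (n * (n - 1) * p ^ 2 - 2 * n * (j - 1) * p + j * (j - 1)) / ((n - j + 1) * (n - j)) := by
  obtain ⟨i, rfl⟩ : ∃ i, j = i + 1 := ⟨j - 1, by omega⟩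
  push_cast at hp0 hp1 ⊢
  simp only [add_sub_cancel_right] at hp0 ⊢
  have hi : (0 : ℝ) ≤ i := i.cast_nonneg
  have hin : (i : ℝ) + 1 + 1 ≤ n := by exact_mod_cast hjn
  have hd : (0 : ℝ) < n - (i + 1) := by linarith
  have hp : p ≤ 1 := by
    by_contra! h
    nlinarith
  set a : ℝ := n * (i + 1 - (n - 1) * p) * (1 - p) / (n - i) with ha
  set b : ℝ := n * ((n - 1) * p - i) * (1 - p) / (n - (i + 1)) with hb
  set c : ℝ := (n * (n - 1) * p ^ 2 - 2 * n * i * p + (i + 1) * i) /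
    ((n - (i + 1) + 1) * (n - (i + 1))) with hc
  have hn0 : (0 : ℝ) ≤ n := n.cast_nonneg
  have hd1 : (0 : ℝ) < n - i := by linarith
  have ha0 : 0 ≤ a :=
    div_nonneg (mul_nonneg (mul_nonneg hn0 (by linarith)) (by linarith)) hd1.le
  have hb0 : 0 ≤ b :=
    div_nonneg (mul_nonneg (mul_nonneg hn0 (by linarith)) (by linarith)) hd.le
  have hc0 : 0 ≤ c := by
    refine div_nonneg ?_ (mul_nonneg (by linarith) hd.le)
    have hn1 : (0 : ℝ) < n - 1 := by linarith
    refine (mul_nonneg_iff_of_pos_left hn1).1 ?_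
    nlinarith [mul_nonneg hn0 (sq_nonneg ((n - 1) * p - i)), mul_nonneg hi hd.le]
  set f : (Fin n → Bool) → ℝ :=
    fun x => a * level n i x + b * level n (i + 1) x + c * level n n x with hf
  have hlevel : ∀ k x, 0 ≤ level n k x := by
    intro k x
    unfold level
    split_ifs <;> positivity
  have hpr : ∀ S, prAll f S * (n.choose S.card : ℝ) =
      a * (i.choose S.card) + b * ((i + 1).choose S.card) + c * (n.choose S.card) := by
    intro S
    have hlin : prAll f S = a * prAll (level n i) S + b * prAll (level n (i + 1)) S
        + c * prAll (level n n) S := by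
      simp only [prAll, hf, Finset.sum_add_distrib, Finset.mul_sum]
    rw [← prAll_level_mul_choose (show i ≤ n by omega) S, ← prAll_level_mul_choose hjn.le S,
      hlin]
    have h := prAll_level_mul_choose le_rfl S
    linear_combination c * h
  have hn : (0 : ℝ) < n := by linarith
  have hn1 : (0 : ℝ) < n - 1 := by linarith
  have h0 : a + b + c = 1 := by
    rw [ha, hb, hc]
    have : (n : ℝ) - (i + 1) + 1 = n - i := by ring
    rw [this]
    field_simp
    ring
  have h1 : a * i + b * (i + 1) + c * n = n * p := by
    rw [ha, hb, hc]
    have : (n : ℝ) - (i + 1) + 1 = n - i := by ring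
    rw [this]
    field_simp
    ring
  have h2 : a * (i * (i - 1)) + b * ((i + 1) * i) + c * (n * (n - 1)) = n * (n - 1) * p ^ 2 := by
    rw [ha, hb, hc]
    have : (n : ℝ) - (i + 1) + 1 = n - i := by ring
    rw [this]
    field_simp
    ring
  refine ⟨f, ⟨fun x => ?_, ?_, fun S hS1 hS2 => ?_⟩, ?_⟩
  · exact add_nonneg (add_nonneg (mul_nonneg ha0 (hlevel _ _)) (mul_nonneg hb0 (hlevel _ _)))
      (mul_nonneg hc0 (hlevel _ _))
  · rw [← prAll_empty]
    simpa [h0] using hpr ∅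
  · have h := hpr S
    obtain hS | hS : S.card = 1 ∨ S.card = 2 := by omega
    · rw [hS] at h ⊢
      simp only [Nat.choose_one_right] at h
      push_cast at h
      refine mul_right_cancel₀ hn.ne' ?_
      linarith
    · rw [hS] at h ⊢
      simp only [Nat.cast_choose_two] at h
      push_cast at h
      refine mul_right_cancel₀ (mul_pos hn hn1).ne' ?_
      linear_combination 2 * h + h2
  · have h := hpr Finset.univ
    simpa [Nat.choose_eq_zero_of_lt (show i < n by omega), Nat.choose_eq_zero_of_lt hjn] using h

/-- closed form for `M(n,2,p)` on the interval `[(j-1)/(n-1), j/(n-1)]`. -/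
theorem stmt1 (n j : ℕ) (hn : 3 ≤ n) (hj1 : 1 ≤ j) (hjn : j ≤ n - 1) (p : ℝ)
    (hp : p ∈ Set.Icc (((j:ℝ) - 1) / ((n:ℝ) - 1)) ((j:ℝ) / ((n:ℝ) - 1))) :
    M n 2 p = (1 / ((n - j + 1).choose 2 : ℝ)) *
      ((n.choose 2 : ℝ) * p ^ 2 - (n:ℝ) * ((j:ℝ) - 1) * p + (j.choose 2 : ℝ)) := by
  have hjn' : j < n := by omega
  have hjR : (j : ℝ) < n := by exact_mod_cast hjn'
  have hn1 : (0 : ℝ) < (n : ℝ) - 1 := by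
    have : (3 : ℝ) ≤ n := by exact_mod_cast hn
    linarith
  have hp0 : (j : ℝ) - 1 ≤ (n - 1) * p := by
    have := (div_le_iff₀ hn1).1 hp.1
    linarith
  have hp1 : (n - 1) * p ≤ (j : ℝ) := by
    have := (le_div_iff₀ hn1).1 hp.2
    linarith
  have hpos : (0 : ℝ) < ((n : ℝ) - j + 1) * (n - j) := mul_pos (by linarith) (by linarith)
  have hval : (1 / ((n - j + 1).choose 2 : ℝ)) *
      ((n.choose 2 : ℝ) * p ^ 2 - (n:ℝ) * ((j:ℝ) - 1) * p + (j.choose 2 : ℝ)) =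
      (n * (n - 1) * p ^ 2 - 2 * n * (j - 1) * p + j * (j - 1)) / ((n - j + 1) * (n - j)) := by
    simp only [Nat.cast_choose_two]
    push_cast [Nat.cast_sub hjn'.le]
    rw [add_sub_cancel_right]
    field_simp
  rw [hval]
  refine IsGreatest.csSup_eq ⟨exists_memA_prAll_univ_eq hj1 hjn' hp0 hp1, ?_⟩
  rintro _ ⟨f, hf, rfl⟩
  rw [le_div_iff₀ hpos]
  have h := hf.prAll_univ_mul_le j
  rwa [sub_sub_eq_add_sub, add_sub_right_comm] at h
end
end

section
/- Let 2 ≤ k ≤ n−1 be integers and let m be an even integer with 0 ≤ m ≤ k. Then for every p ∈ [0,1], M(n,k,p) ≤ (1/C(n−k+m−1, m)) · p^{k−m} · B(n−k+m, m, p). -/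
open scoped BigOperators

noncomputable section

theorem prAll_eq_sum_ite {n : ℕ} (f : (Fin n → Bool) → ℝ) (S : Finset (Fin n)) :
    prAll f S = ∑ x, if ∀ i ∈ S, x i = true then f x else 0 := by
  rw [prAll, Finset.sum_filter]

theorem memA.prAll_eq {n k : ℕ} {p : ℝ} {f : (Fin n → Bool) → ℝ} (hf : memA n k p f)
    (S : Finset (Fin n)) (hS : S.card ≤ k) : prAll f S = p ^ S.card := by
  rcases S.eq_empty_or_nonempty with rfl | h
  · simpa [prAll] using hf.2.1
  · exact hf.2.2 S h.card_pos hS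

/-- Under the product Bernoulli measure, the coordinates are independent. -/
theorem prAll_prod_bernoulli {n : ℕ} (p : ℝ) (S : Finset (Fin n)) :
    prAll (fun x => ∏ i, if x i = true then p else 1 - p) S = p ^ S.card := by
  have hS : Finset.univ.filter (fun x : Fin n → Bool => ∀ i ∈ S, x i = true) =
      Fintype.piFinset (fun i => if i ∈ S then {true} else Finset.univ) := by
    ext x
    simp only [Finset.mem_filter, Finset.mem_univ, true_and, Fintype.mem_piFinset]
    refine forall_congr' fun i => ?_
    by_cases h : i ∈ S <;> simp [h]
  rw [prAll, hS, ← Finset.prod_univ_sum (fun i => if i ∈ S then {true} else Finset.univ)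
    (fun _ b => if b = true then p else 1 - p)]
  have h (i : Fin n) : (∑ b ∈ (if i ∈ S then {true} else Finset.univ : Finset Bool),
      if b = true then p else 1 - p) = if i ∈ S then p else 1 := by
    by_cases h : i ∈ S <;> simp [h]
  simp only [h]
  simp

theorem exists_memA (n k : ℕ) (p : ℝ) (hp : p ∈ Set.Icc (0 : ℝ) 1) : ∃ f, memA n k p f := by
  refine ⟨fun x => ∏ i, if x i = true then p else 1 - p, fun x => ?_, ?_, fun S _ _ =>
    prAll_prod_bernoulli p S⟩
  · refine Finset.prod_nonneg fun i _ => ?_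
    split_ifs
    exacts [hp.1, sub_nonneg.2 hp.2]
  · simpa [prAll] using prAll_prod_bernoulli (n := n) p ∅

theorem alternating_sum_choose_nonneg (s m : ℕ) (hm : Even m) :
    0 ≤ ∑ i ∈ Finset.range (m + 1), (-1 : ℝ) ^ i * (s.choose i) := by
  rcases s with _ | s
  · simp [Finset.sum_range_succ']
  · have h := Int.alternating_sum_range_choose_eq_choose (n := s) (m := m)
    have h' : ∑ i ∈ Finset.range (m + 1), (-1 : ℝ) ^ i * ((s + 1).choose i) = s.choose m := by
      rw [hm.neg_one_pow, one_mul] at h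
      exact_mod_cast h
    rw [h']
    positivity

/-- The binomial moment of the number of ones in `U`, on the event that `T` is all ones. -/
theorem memA.sum_choose {n k : ℕ} {p : ℝ} {f : (Fin n → Bool) → ℝ} (hf : memA n k p f)
    (T : Finset (Fin n)) (i : ℕ) (hi : T.card + i ≤ k) :
    ∑ x, (if ∀ j ∈ T, x j = true then f x else 0) *
        (((Tᶜ.filter fun j => x j = true).card.choose i : ℕ) : ℝ) =
      (Tᶜ.card.choose i : ℝ) * p ^ (T.card + i) := by
  have hcount (x : Fin n → Bool) : (((Tᶜ.filter fun j => x j = true).card.choose i : ℕ) : ℝ) =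
      ∑ V ∈ Finset.powersetCard i Tᶜ, if ∀ j ∈ V, x j = true then 1 else 0 := by
    rw [← Finset.card_powersetCard, Finset.sum_boole]
    congr 2
    ext V
    simp only [Finset.mem_powersetCard, Finset.mem_filter, Finset.subset_iff]
    grind
  have hterm : ∀ V ∈ Finset.powersetCard i Tᶜ, ∑ x, (if ∀ j ∈ T, x j = true then f x else 0) *
      (if ∀ j ∈ V, x j = true then (1 : ℝ) else 0) = p ^ (T.card + i) := by
    intro V hV
    obtain ⟨hVT, hVi⟩ := Finset.mem_powersetCard.1 hV
    have hc : (T ∪ V).card = T.card + i := by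
      rw [Finset.card_union_of_disjoint, hVi]
      exact Finset.disjoint_left.2 fun a ha hb => Finset.mem_compl.1 (hVT hb) ha
    rw [← hc, ← hf.prAll_eq _ (hc.trans_le hi), prAll_eq_sum_ite]
    refine Finset.sum_congr rfl fun x _ => ?_
    simp only [Finset.mem_union, or_imp, forall_and]
    split_ifs <;> simp_all
  simp_rw [hcount, Finset.mul_sum]
  rw [Finset.sum_comm, Finset.sum_congr rfl hterm, Finset.sum_const, Finset.card_powersetCard,
    nsmul_eq_mul]

/-- upper bound on `M(n,k,p)` in terms of Bonferroni polynomials, even `m ≤ k`. -/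
theorem stmt4 (n k m : ℕ) (hk : 2 ≤ k) (hkn : k + 1 ≤ n) (hm : m ≤ k) (hme : Even m)
    (p : ℝ) (hp : p ∈ Set.Icc (0:ℝ) 1) :
    M n k p ≤ (1 / ((n - k + m - 1).choose m : ℝ)) * p ^ (k - m) * bonf (n - k + m) (m : ℤ) p := by
  obtain ⟨f₀, hf₀⟩ := exists_memA n k p hp
  refine csSup_le ⟨_, f₀, hf₀, rfl⟩ ?_
  rintro _ ⟨f, hf, rfl⟩
  obtain ⟨T, -, hT⟩ := Finset.exists_subset_card_eq (s := (Finset.univ : Finset (Fin n)))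
    (n := k - m) (by simp; omega)
  have hTc : Tᶜ.card = n - k + m := by
    rw [Finset.card_compl, hT, Fintype.card_fin]
    omega
  set g : (Fin n → Bool) → ℝ := fun x => (if ∀ j ∈ T, x j = true then f x else 0) *
    ∑ i ∈ Finset.range (m + 1),
      (-1 : ℝ) ^ i * (((Tᶜ.filter fun j => x j = true).card.choose i : ℕ) : ℝ) with hg
  have hsum : ∑ x, g x = p ^ (k - m) * bonf (n - k + m) m p := by
    simp only [hg, Finset.mul_sum]
    rw [Finset.sum_comm, bonf, if_neg (by omega), Int.toNat_natCast, Finset.mul_sum]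
    refine Finset.sum_congr rfl fun i hi => ?_
    simp only [mul_left_comm _ ((-1 : ℝ) ^ i)]
    have := Finset.mem_range.1 hi
    rw [← Finset.mul_sum, hf.sum_choose T i (by omega), hTc, hT, pow_add]
    ring
  have hnonneg (x) : 0 ≤ g x := by
    refine mul_nonneg ?_ (alternating_sum_choose_nonneg _ _ hme)
    split_ifs
    exacts [hf.1 x, le_rfl]
  have htop : g (fun _ => true) = prAll f Finset.univ * ((n - k + m - 1).choose m : ℝ) := by
    have hset : Finset.univ.filter (fun x : Fin n → Bool => ∀ i ∈ Finset.univ, x i = true) =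
        {fun _ => true} := by
      ext x
      simp [funext_iff]
    have h := Int.alternating_sum_range_choose_eq_choose (n := n - k + m - 1) (m := m)
    rw [hme.neg_one_pow, one_mul, show n - k + m - 1 + 1 = n - k + m by omega] at h
    have h' : ∑ i ∈ Finset.range (m + 1), (-1 : ℝ) ^ i * ((n - k + m).choose i) =
        (n - k + m - 1).choose m := by
      exact_mod_cast h
    rw [prAll, hset, Finset.sum_singleton, ← h']
    simp [hg, hTc]
  have hpos : (0 : ℝ) < (n - k + m - 1).choose m := by
    exact_mod_cast Nat.choose_pos (by omega)
  rw [mul_assoc, one_div, inv_mul_eq_div, le_div_iff₀ hpos, ← hsum, ← htop]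
  exact Finset.single_le_sum (fun x _ => hnonneg x) (Finset.mem_univ _)
end
end

section
/- Let 1 ≤ k ≤ n be integers and let p be a real number. Define v_i = (1−p)·p^i·B(n−i−1, k−i−1, p) for 0 ≤ i ≤ k−1, v_i = 0 for k ≤ i ≤ n−1, and v_n = p^k. Then for every integer t with 0 ≤ t ≤ k, the identity Σ_{i=t}^{n} C(n−t, i−t) · v_i = p^t holds. -/
open scoped BigOperators

noncomputable section

/-- Vandermonde's identity for the upper arguments `m` and `s - m`, the latter being negative. -/
theorem sum_choose_mul_neg_one_pow_mul_choose {m s : ℕ} (hs : s < m) :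
    ∑ j ∈ Finset.range (s + 1),
      (m.choose j : ℝ) * ((-1) ^ (s - j) * ((m - j - 1).choose (s - j) : ℝ)) = 1 := by
  have h := Ring.add_choose_eq (R := ℝ) s (Commute.all (m : ℝ) (-((m : ℝ) - s)))
  rw [show (m : ℝ) + -((m : ℝ) - s) = (s : ℕ) by ring, Ring.choose_natCast, Nat.choose_self,
    Finset.Nat.sum_antidiagonal_eq_sum_range_succ
      (fun i j => Ring.choose (m : ℝ) i * Ring.choose (-((m : ℝ) - s)) j)] at h
  rw [Nat.cast_one] at h
  refine (Finset.sum_congr rfl fun j hj => ?_).trans h.symm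
  have hj : j ≤ s := Nat.lt_succ_iff.mp (Finset.mem_range.mp hj)
  have hcast : (m : ℝ) - s + ((s - j : ℕ) : ℝ) - 1 = ((m - j - 1 : ℕ) : ℝ) := by
    rw [Nat.cast_sub hj, Nat.cast_sub (by omega), Nat.cast_sub (by omega)]
    push_cast
    ring
  rw [Ring.choose_natCast, Ring.choose_neg, hcast, Ring.choose_natCast,
    Int.negOnePow_def, Units.smul_def]
  simp

theorem bonf_natCast (m l : ℕ) (x : ℝ) :
    bonf m l x = ∑ i ∈ Finset.range (l + 1), (-1 : ℝ) ^ i * (m.choose i) * x ^ i := by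
  simp [bonf]

theorem sum_choose_mul_pow_mul_bonf {m l : ℕ} (hl : l ≤ m) (x : ℝ) :
    ∑ j ∈ Finset.range l, (m.choose j : ℝ) * x ^ j * bonf (m - j - 1) ((l : ℤ) - j - 1) x =
      ∑ s ∈ Finset.range l, x ^ s := by
  calc
    _ = ∑ j ∈ Finset.range l, ∑ i ∈ Finset.range (l - j),
          (m.choose j : ℝ) * x ^ j * ((-1) ^ i * ((m - j - 1).choose i) * x ^ i) := by
      refine Finset.sum_congr rfl fun j hj => ?_
      have hj := Finset.mem_range.mp hj
      rw [show (l : ℤ) - j - 1 = ((l - j - 1 : ℕ) : ℤ) by omega, bonf_natCast,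
        show l - j - 1 + 1 = l - j by omega, Finset.mul_sum]
    _ = ∑ s ∈ Finset.range l, x ^ s := by
      rw [← Finset.sum_range_diag_flip l fun j i =>
        (m.choose j : ℝ) * x ^ j * ((-1) ^ i * ((m - j - 1).choose i) * x ^ i)]
      refine Finset.sum_congr rfl fun s hs => ?_
      have h := congrArg (· * x ^ s)
        (sum_choose_mul_neg_one_pow_mul_choose ((Finset.mem_range.mp hs).trans_le hl))
      simp only [one_mul, Finset.sum_mul] at h
      rw [← h]
      refine Finset.sum_congr rfl fun j hj => ?_
      rw [← pow_mul_pow_sub x (Nat.lt_succ_iff.mp (Finset.mem_range.mp hj))]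
      ring

/-- the weights `v_i` given by
`v_i = (1-p) p^i B(n-i-1, k-i-1, p)` for `0 ≤ i ≤ k-1`, `v_i = 0` for `k ≤ i ≤ n-1`,
and `v_n = p^k`, satisfy the constraints `Σ_{i=t}^{n} C(n-t, i-t) v_i = p^t` for `0 ≤ t ≤ k`. -/
theorem stmt7 (n k : ℕ) (hk1 : 1 ≤ k) (hkn : k ≤ n) (p : ℝ) (v : ℕ → ℝ)
    (hv1 : ∀ i, i < k → v i = (1 - p) * p ^ i * bonf (n - i - 1) ((k:ℤ) - i - 1) p)
    (hv2 : ∀ i, k ≤ i → i < n → v i = 0)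
    (hv3 : v n = p ^ k) :
    ∀ t : ℕ, t ≤ k → ∑ i ∈ Finset.Icc t n, ((n - t).choose (i - t) : ℝ) * v i = p ^ t := by
  intro t ht
  obtain ⟨l, rfl⟩ := Nat.exists_eq_add_of_le ht
  obtain ⟨m, rfl⟩ := Nat.exists_eq_add_of_le (ht.trans hkn)
  have hlm : l ≤ m := by omega
  rw [← Finset.Ico_add_one_right_eq_Icc, Finset.sum_Ico_eq_sum_range,
    show t + m + 1 - t = m + 1 by omega, Finset.sum_range_succ, hv3]
  simp only [Nat.add_sub_cancel_left, Nat.choose_self, Nat.cast_one, one_mul]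
  rw [← Finset.sum_subset (Finset.range_subset_range.mpr hlm) fun j hj hj' => by
    rw [Finset.mem_range] at hj hj'
    rw [hv2 (t + j) (by omega) (by omega), mul_zero]]
  have hsum : ∑ j ∈ Finset.range l, (m.choose j : ℝ) * v (t + j) =
      p ^ t * ((1 - p) * ∑ s ∈ Finset.range l, p ^ s) := by
    rw [← sum_choose_mul_pow_mul_bonf hlm, Finset.mul_sum, Finset.mul_sum]
    refine Finset.sum_congr rfl fun j hj => ?_
    rw [hv1 (t + j) (by have := Finset.mem_range.mp hj; omega),
      show t + m - (t + j) - 1 = m - j - 1 by omega,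
      show ((t + l : ℕ) : ℤ) - (t + j : ℕ) - 1 = (l : ℤ) - j - 1 by push_cast; ring]
    ring
  rw [hsum, mul_neg_geom_sum]
  ring
end
end

section
/- Let 2 ≤ k ≤ n−1 be integers with k even. Then for every p with 1 − 1/(n−k+1) ≤ p ≤ 1, M(n,k,p) = B(n, k, 1−p). -/
open scoped BigOperators

noncomputable section

/-- A truncated sum over subsets of `Z` of a function of the cardinality. -/
lemma sum_powerset_truncated {α : Type*} (Z : Finset α) (k : ℕ) (g : ℕ → ℝ) :
    ∑ U ∈ Z.powerset, (if U.card ≤ k then g U.card else 0) =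
      ∑ i ∈ Finset.range (k + 1), (Z.card.choose i : ℝ) * g i := by
  rw [Finset.sum_powerset_apply_card (fun m => if m ≤ k then g m else 0)]
  simp only [nsmul_eq_mul, mul_ite, mul_zero]
  rw [← Finset.sum_filter]
  refine Finset.sum_subset ?_ ?_
  · intro i hi
    simp only [Finset.mem_filter, Finset.mem_range] at hi ⊢
    omega
  · intro i hi hi'
    simp only [Finset.mem_filter, Finset.mem_range] at hi hi'
    rw [Nat.choose_eq_zero_of_lt (by omega)]
    simp

/-- The truncated binomial expansion of `(1 - x) ^ m`. -/
def truncatedBinomial (m l : ℕ) (x : ℝ) : ℝ :=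
  ∑ i ∈ Finset.range (l + 1), (m.choose i : ℝ) * (-x) ^ i

lemma bonf_natCast_s8 (m l : ℕ) (x : ℝ) : bonf m (l : ℤ) x = truncatedBinomial m l x := by
  unfold bonf truncatedBinomial
  rw [if_neg (by omega), Int.toNat_natCast]
  refine Finset.sum_congr rfl fun i _ => ?_
  rw [neg_pow x]
  ring

lemma truncatedBinomial_succ_succ (m l : ℕ) (x : ℝ) :
    truncatedBinomial (m + 1) (l + 1) x =
      (1 - x) * truncatedBinomial m l x + (m.choose (l + 1) : ℝ) * (-x) ^ (l + 1) := by
  have h1 : truncatedBinomial (m + 1) (l + 1) x =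
      truncatedBinomial m (l + 1) x + (-x) * truncatedBinomial m l x := by
    unfold truncatedBinomial
    rw [Finset.sum_range_succ', Finset.sum_range_succ' _ (l + 1), Finset.mul_sum]
    simp only [Nat.choose_succ_succ, Nat.cast_add, add_mul, Finset.sum_add_distrib,
      Nat.choose_zero_right]
    have h : ∀ i, (m.choose i : ℝ) * (-x) ^ (i + 1) = -x * ((m.choose i : ℝ) * (-x) ^ i) :=
      fun i => by ring
    simp only [h]
    ring
  have h2 : truncatedBinomial m (l + 1) x =
      truncatedBinomial m l x + (m.choose (l + 1) : ℝ) * (-x) ^ (l + 1) := by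
    unfold truncatedBinomial
    rw [Finset.sum_range_succ]
  rw [h1, h2]
  ring

lemma truncatedBinomial_odd_nonneg_of_even (e r : ℕ) (x : ℝ) (hx : 0 ≤ x) (hx1 : x ≤ 1)
    (hex : (e + 1) * x ≤ 1 - x)
    (h : ((e + 2 * r).choose (2 * r) : ℝ) * x ^ (2 * r) ≤
      truncatedBinomial (e + 1 + 2 * r) (2 * r) x) :
    0 ≤ truncatedBinomial (e + 1 + (2 * r + 1)) (2 * r + 1) x := by
  rw [← add_assoc (e + 1), truncatedBinomial_succ_succ, Odd.neg_pow ⟨r, rfl⟩]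
  have hc : ((e + 1 + 2 * r).choose (2 * r + 1) : ℝ) * (2 * r + 1) =
      (e + 2 * r + 1) * ((e + 2 * r).choose (2 * r) : ℝ) := by
    have := Nat.add_one_mul_choose_eq (e + 2 * r) (2 * r)
    rw [show e + 1 + 2 * r = e + 2 * r + 1 by ring]
    exact_mod_cast this.symm
  set C : ℝ := ((e + 2 * r).choose (2 * r) : ℝ)
  have hC : (0 : ℝ) ≤ C := Nat.cast_nonneg _
  have hle : ((e + 1 + 2 * r).choose (2 * r + 1) : ℝ) ≤ (e + 1) * C := by
    have h3 : (0 : ℝ) < 2 * r + 1 := by positivity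
    refine le_of_mul_le_mul_right ?_ h3
    rw [hc]
    have : (0 : ℝ) ≤ 2 * r * e * C := by positivity
    nlinarith
  have h4 := mul_le_mul_of_nonneg_left h (sub_nonneg.2 hx1)
  have hp : 0 ≤ x ^ (2 * r) := by positivity
  have h5 := mul_le_mul_of_nonneg_right hle (pow_nonneg hx (2 * r + 1))
  have h6 := mul_le_mul_of_nonneg_right hex (mul_nonneg hC hp)
  have h7 : (e + 1) * C * x ^ (2 * r + 1) = (e + 1) * x * (C * x ^ (2 * r)) := by ring
  linarith

lemma truncatedBinomial_even_lower_bound (e r : ℕ) (x : ℝ) (hx : 0 ≤ x) (hx1 : x ≤ 1)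
    (hex : (e + 1) * x ≤ 1 - x) :
    ((e + 2 * r).choose (2 * r) : ℝ) * x ^ (2 * r) ≤
      truncatedBinomial (e + 1 + 2 * r) (2 * r) x := by
  induction r with
  | zero => simp [truncatedBinomial]
  | succ r ih =>
    have h := truncatedBinomial_odd_nonneg_of_even e r x hx hx1 hex ih
    have hrec := truncatedBinomial_succ_succ (e + 1 + (2 * r + 1)) (2 * r + 1) x
    rw [Even.neg_pow ⟨r + 1, by ring⟩] at hrec
    rw [show e + 1 + 2 * (r + 1) = e + 1 + (2 * r + 1) + 1 by ring,
      show 2 * (r + 1) = 2 * r + 1 + 1 by ring, hrec,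
      show e + (2 * r + 1 + 1) = e + 1 + (2 * r + 1) by ring]
    have := mul_nonneg (sub_nonneg.2 hx1) h
    linarith

/-- `B(e + 1 + l, l, x)` is nonnegative for `0 ≤ x ≤ 1 / (e + 2)`. -/
lemma truncatedBinomial_nonneg (e l : ℕ) (x : ℝ) (hx : 0 ≤ x)
    (hex : (e + 1) * x ≤ 1 - x) : 0 ≤ truncatedBinomial (e + 1 + l) l x := by
  have hx1 : x ≤ 1 := by
    have : 0 ≤ (e + 1) * x := by positivity
    linarith
  obtain ⟨r, rfl | rfl⟩ := Nat.even_or_odd' l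
  · exact le_trans (by positivity) (truncatedBinomial_even_lower_bound e r x hx hx1 hex)
  · exact truncatedBinomial_odd_nonneg_of_even e r x hx hx1 hex
      (truncatedBinomial_even_lower_bound e r x hx hx1 hex)

/-- Bonferroni inequality for an even truncation level, for a fixed number `N` of events. -/
lemma ite_eq_zero_le_truncatedBinomial_one (N k : ℕ) (hk : Even k) :
    (if N = 0 then 1 else 0) ≤ truncatedBinomial N k 1 := by
  have h : truncatedBinomial N k 1 =
      ((∑ i ∈ Finset.range (k + 1), ((-1) ^ i * N.choose i : ℤ) : ℤ) : ℝ) := by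
    unfold truncatedBinomial
    push_cast
    exact Finset.sum_congr rfl fun i _ => mul_comm _ _
  rw [h]
  cases N with
  | zero =>
    simp only [if_true]
    rw [Finset.sum_range_succ']
    simp
  | succ N =>
    rw [Int.alternating_sum_range_choose_eq_choose, hk.neg_one_pow]
    simp

lemma sum_powerset_neg_one_pow_card_real {α : Type*} [DecidableEq α] (A : Finset α) :
    ∑ T ∈ A.powerset, (-1 : ℝ) ^ T.card = if A = ∅ then 1 else 0 := by
  have := congrArg (Int.cast : ℤ → ℝ) (Finset.sum_powerset_neg_one_pow_card (x := A))
  push_cast at this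
  exact this

lemma sum_powerset_pow_card {α : Type*} (A : Finset α) (y : ℝ) :
    ∑ T ∈ A.powerset, y ^ T.card = (1 + y) ^ A.card := by
  have := Finset.sum_pow_mul_eq_add_pow y 1 A
  simp only [one_pow, mul_one] at this
  rw [this, add_comm]

/-- The set of coordinates at which `x` vanishes. -/
def zeros {n : ℕ} (x : Fin n → Bool) : Finset (Fin n) :=
  Finset.univ.filter fun i => x i = false

lemma zeros_bijective (n : ℕ) : Function.Bijective (zeros (n := n)) := by
  refine Function.bijective_iff_has_inverse.2 ⟨fun T i => decide (i ∉ T), ?_, ?_⟩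
  · intro x
    funext i
    simp [zeros]
  · intro T
    ext i
    simp [zeros]

lemma zeros_subset_compl_iff {n : ℕ} (x : Fin n → Bool) (S : Finset (Fin n)) :
    zeros x ⊆ Sᶜ ↔ ∀ i ∈ S, x i = true := by
  simp only [zeros, Finset.subset_iff, Finset.mem_filter, Finset.mem_univ, true_and,
    Finset.mem_compl]
  refine forall_congr' fun i => ?_
  cases x i <;> simp

lemma prAll_comp_zeros {n : ℕ} (g : Finset (Fin n) → ℝ) (S : Finset (Fin n)) :
    prAll (fun x => g (zeros x)) S = ∑ T ∈ Sᶜ.powerset, g T := by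
  unfold prAll
  rw [Finset.sum_filter]
  simp only [← zeros_subset_compl_iff]
  rw [(zeros_bijective n).sum_comp (fun T => if T ⊆ Sᶜ then g T else 0), ← Finset.sum_filter]
  refine Finset.sum_congr ?_ fun _ _ => rfl
  ext T
  simp

/-- The probability that the set of zeros is `T` under the extremal measure, obtained by Möbius
inversion from the prescribed probabilities that the zeros contain a given set. -/
def extremalMass (n k : ℕ) (q : ℝ) (T : Finset (Fin n)) : ℝ :=
  ∑ U : Finset (Fin n), if T ⊆ U ∧ U.card ≤ k then (-1) ^ T.card * (-q) ^ U.card else 0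

lemma extremalMass_eq_zero {n k : ℕ} {q : ℝ} {T : Finset (Fin n)} (hT : k < T.card) :
    extremalMass n k q T = 0 := by
  refine Finset.sum_eq_zero fun U _ => if_neg ?_
  rintro ⟨h1, h2⟩
  have := Finset.card_le_card h1
  omega

lemma extremalMass_eq {n k : ℕ} {q : ℝ} {T : Finset (Fin n)} (hT : T.card ≤ k) :
    extremalMass n k q T = q ^ T.card * truncatedBinomial (n - T.card) (k - T.card) q := by
  have hc : n - T.card = (Tᶜ).card := by rw [Finset.card_compl, Fintype.card_fin]
  unfold truncatedBinomial
  rw [hc, ← sum_powerset_truncated Tᶜ (k - T.card) (fun i => (-q) ^ i), Finset.mul_sum]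
  unfold extremalMass
  rw [← Finset.sum_filter]
  simp only [mul_ite, mul_zero]
  rw [← Finset.sum_filter]
  refine Finset.sum_nbij' (fun U => U \ T) (fun V => T ∪ V) ?_ ?_ ?_ ?_ ?_
  · intro U hU
    simp only [Finset.mem_filter, Finset.mem_univ, true_and, Finset.mem_powerset] at hU ⊢
    refine ⟨fun i hi => by simp at hi ⊢; exact hi.2, ?_⟩
    rw [Finset.card_sdiff_of_subset hU.1]
    omega
  · intro V hV
    simp only [Finset.mem_filter, Finset.mem_univ, true_and, Finset.mem_powerset] at hV ⊢
    refine ⟨Finset.subset_union_left, (Finset.card_union_le _ _).trans ?_⟩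
    omega
  · intro U hU
    simp only [Finset.mem_filter] at hU
    exact Finset.union_sdiff_of_subset hU.2.1
  · intro V hV
    simp only [Finset.mem_filter, Finset.mem_powerset] at hV
    have : Disjoint T V := (Finset.disjoint_left.2 fun i hi hi' =>
      Finset.mem_compl.1 (hV.1 hi') hi)
    exact Finset.union_sdiff_cancel_left this
  · intro U hU
    simp only [Finset.mem_filter] at hU
    have hle := Finset.card_le_card hU.2.1
    rw [Finset.card_sdiff_of_subset hU.2.1]
    obtain ⟨c, hc⟩ := Nat.exists_eq_add_of_le hle
    rw [hc, Nat.add_sub_cancel_left, pow_add, ← mul_assoc, ← mul_pow]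
    simp

lemma extremalMass_nonneg {n k : ℕ} (hkn : k + 1 ≤ n) {q : ℝ} (hq : 0 ≤ q)
    (hq' : ((n : ℝ) - k + 1) * q ≤ 1) (T : Finset (Fin n)) : 0 ≤ extremalMass n k q T := by
  rcases lt_or_ge k T.card with hT | hT
  · rw [extremalMass_eq_zero hT]
  · rw [extremalMass_eq hT]
    obtain ⟨e, rfl⟩ := Nat.exists_eq_add_of_le hkn
    rw [show k + 1 + e - T.card = e + 1 + (k - T.card) by omega]
    refine mul_nonneg (pow_nonneg hq _) (truncatedBinomial_nonneg _ _ _ hq ?_)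
    push_cast at hq'
    linarith

lemma sum_powerset_compl_extremalMass {n k : ℕ} (q : ℝ) (S : Finset (Fin n)) :
    ∑ T ∈ Sᶜ.powerset, extremalMass n k q T =
      ∑ U ∈ S.powerset, if U.card ≤ k then (-q) ^ U.card else 0 := by
  unfold extremalMass
  rw [Finset.sum_comm]
  have h : ∀ U : Finset (Fin n),
      (∑ T ∈ Sᶜ.powerset, if T ⊆ U ∧ U.card ≤ k then (-1) ^ T.card * (-q) ^ U.card else 0) =
        if U ⊆ S then (if U.card ≤ k then (-q) ^ U.card else 0) else 0 := by
    intro U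
    have h1 : Sᶜ.powerset.filter (fun T => T ⊆ U) = (Sᶜ ∩ U).powerset := by
      ext T
      simp only [Finset.mem_filter, Finset.mem_powerset, Finset.subset_inter_iff]
    have h2 : Sᶜ ∩ U = ∅ ↔ U ⊆ S := by
      rw [← Finset.disjoint_iff_inter_eq_empty, disjoint_comm,
        ← Finset.subset_compl_iff_disjoint_right, compl_compl]
    by_cases hU : U.card ≤ k
    · simp only [hU, and_true, if_true]
      rw [← Finset.sum_filter, h1, ← Finset.sum_mul, sum_powerset_neg_one_pow_card_real]
      simp [h2]
    · simp [hU]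
  rw [Finset.sum_congr rfl fun U _ => h U, ← Finset.sum_filter]
  refine Finset.sum_congr ?_ fun _ _ => rfl
  ext U
  simp

lemma prAll_extremalMass (n k : ℕ) (q : ℝ) (S : Finset (Fin n)) :
    prAll (fun x => extremalMass n k q (zeros x)) S = truncatedBinomial S.card k q := by
  rw [prAll_comp_zeros, sum_powerset_compl_extremalMass,
    sum_powerset_truncated S k (fun i => (-q) ^ i), truncatedBinomial]

lemma prAll_extremalMass_of_card_le {n k : ℕ} (q : ℝ) {S : Finset (Fin n)} (hS : S.card ≤ k) :
    prAll (fun x => extremalMass n k q (zeros x)) S = (1 - q) ^ S.card := by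
  rw [prAll_comp_zeros, sum_powerset_compl_extremalMass, sub_eq_add_neg, ← sum_powerset_pow_card]
  refine Finset.sum_congr rfl fun U hU => if_pos ?_
  exact (Finset.card_le_card (Finset.mem_powerset.1 hU)).trans hS

lemma memA_extremalMass {n k : ℕ} (hkn : k + 1 ≤ n) {p : ℝ} (hp : p ≤ 1)
    (hp' : ((n : ℝ) - k + 1) * (1 - p) ≤ 1) :
    memA n k p (fun x => extremalMass n k (1 - p) (zeros x)) := by
  refine ⟨fun x => extremalMass_nonneg hkn (by linarith) hp' _, ?_, fun S _ hS => ?_⟩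
  · rw [← prAll_empty, prAll_extremalMass_of_card_le _ (by simp)]
    simp
  · rw [prAll_extremalMass_of_card_le _ hS]
    ring

/-- Inclusion-exclusion: under `k`-wise independence the zeros contain a given set `U` of size at
most `k` with probability `(1 - p) ^ |U|`. -/
lemma memA.sum_subset_zeros {n k : ℕ} {p : ℝ} {f : (Fin n → Bool) → ℝ} (hf : memA n k p f)
    {U : Finset (Fin n)} (hU : U.card ≤ k) :
    ∑ x, (if U ⊆ zeros x then f x else 0) = (1 - p) ^ U.card := by
  have hpr : ∀ W ∈ U.powerset, (-1) ^ W.card * prAll f W = (-p) ^ W.card := by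
    intro W hW
    rw [neg_pow p]
    congr 1
    rcases Nat.eq_zero_or_pos W.card with h | h
    · rw [Finset.card_eq_zero] at h
      rw [h, prAll_empty, hf.2.1]
      simp
    · exact hf.2.2 W h ((Finset.card_le_card (Finset.mem_powerset.1 hW)).trans hU)
  rw [sub_eq_add_neg, ← sum_powerset_pow_card, ← Finset.sum_congr rfl hpr]
  unfold prAll
  simp only [Finset.mul_sum, Finset.sum_filter, ← zeros_subset_compl_iff]
  rw [Finset.sum_comm]
  refine Finset.sum_congr rfl fun x _ => ?_
  have h1 : U.powerset.filter (fun W => zeros x ⊆ Wᶜ) = (U ∩ (zeros x)ᶜ).powerset := by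
    ext W
    simp only [Finset.mem_filter, Finset.mem_powerset, Finset.subset_inter_iff]
    rw [Finset.subset_compl_comm]
  have h2 : U ∩ (zeros x)ᶜ = ∅ ↔ U ⊆ zeros x := by
    rw [← Finset.disjoint_iff_inter_eq_empty, ← Finset.subset_compl_iff_disjoint_right, compl_compl]
  have h3 := sum_powerset_neg_one_pow_card_real (U ∩ (zeros x)ᶜ)
  simp only [mul_ite, mul_zero]
  rw [← Finset.sum_filter, h1, ← Finset.sum_mul, h3]
  simp [h2]

lemma prAll_univ_s8 {n : ℕ} (f : (Fin n → Bool) → ℝ) :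
    prAll f Finset.univ = ∑ x, f x * (if (zeros x).card = 0 then 1 else 0) := by
  unfold prAll
  rw [Finset.sum_filter]
  refine Finset.sum_congr rfl fun x _ => ?_
  simp only [← zeros_subset_compl_iff]
  simp

lemma memA.prAll_univ_le {n k : ℕ} {p : ℝ} {f : (Fin n → Bool) → ℝ} (hf : memA n k p f)
    (hk : Even k) : prAll f Finset.univ ≤ truncatedBinomial n k (1 - p) := by
  have h : truncatedBinomial n k (1 - p) =
      ∑ x, f x * truncatedBinomial (zeros x).card k 1 := by
    have h1 := sum_powerset_truncated (Finset.univ : Finset (Fin n)) k (fun i => (-(1 - p)) ^ i)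
    rw [Finset.card_univ, Fintype.card_fin] at h1
    unfold truncatedBinomial
    rw [← h1, Finset.powerset_univ]
    have h2 : ∀ U : Finset (Fin n), (if U.card ≤ k then (-(1 - p)) ^ U.card else 0) =
        ∑ x, (if U ⊆ zeros x then f x * (if U.card ≤ k then (-1) ^ U.card else 0) else 0) := by
      intro U
      by_cases hU : U.card ≤ k
      · simp only [hU, if_true]
        rw [neg_pow, ← hf.sum_subset_zeros hU, Finset.mul_sum]
        refine Finset.sum_congr rfl fun x _ => ?_
        split_ifs <;> ring
      · simp [hU]
    rw [Finset.sum_congr rfl fun U _ => h2 U, Finset.sum_comm]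
    refine Finset.sum_congr rfl fun x _ => ?_
    rw [← sum_powerset_truncated (zeros x) k (fun i => (-1 : ℝ) ^ i), Finset.mul_sum,
      ← Finset.sum_filter]
    refine Finset.sum_congr ?_ fun _ _ => rfl
    ext U
    simp
  rw [h, prAll_univ_s8]
  exact Finset.sum_le_sum fun x _ =>
    mul_le_mul_of_nonneg_left (ite_eq_zero_le_truncatedBinomial_one _ _ hk) (hf.1 x)

/-- for even `k`, `M(n,k,p) = B(n,k,1-p)` on the last interval
`[1 - 1/(n-k+1), 1]`. -/
theorem stmt8 (n k : ℕ) (hk : 2 ≤ k) (hkn : k + 1 ≤ n) (hke : Even k) (p : ℝ)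
    (hp1 : 1 - 1 / ((n:ℝ) - (k:ℝ) + 1) ≤ p) (hp2 : p ≤ 1) :
    M n k p = bonf n (k : ℤ) (1 - p) := by
  have hpos : (0 : ℝ) < (n : ℝ) - k + 1 := by
    have : (k : ℝ) + 1 ≤ n := by exact_mod_cast hkn
    linarith
  have hq : ((n : ℝ) - k + 1) * (1 - p) ≤ 1 := by
    rw [mul_comm, ← le_div_iff₀ hpos]
    linarith
  rw [bonf_natCast_s8]
  refine IsGreatest.csSup_eq ⟨⟨_, memA_extremalMass hkn hp2 hq, ?_⟩, ?_⟩
  · rw [prAll_extremalMass, Finset.card_univ, Fintype.card_fin]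
  · rintro y ⟨f, hf, rfl⟩
    exact hf.prAll_univ_le hke
end
end

section
/- Let 0 ≤ k ≤ n be integers and let p be a real number. Then for every integer i with 0 ≤ i ≤ k, the identity Σ_{j=0}^{i} C(n−k, i−j) · (1−p)^{k−j} · B(n−k+j, j, 1−p) = p^i · (1−p)^{k−i} holds. -/
open scoped BigOperators

noncomputable section

theorem bonf_zero_right (m : ℕ) (x : ℝ) : bonf m 0 x = 1 := by
  simp [bonf]

theorem bonf_succ_succ (m l : ℕ) (x : ℝ) :
    bonf (m + 1) (l + 1 : ℕ) x = bonf m (l + 1 : ℕ) x - x * bonf m l x := by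
  simp only [bonf_natCast]
  rw [Finset.sum_range_succ', Finset.sum_range_succ' _ (l + 1), Finset.mul_sum,
    add_sub_right_comm, ← Finset.sum_sub_distrib]
  congr 1
  · refine Finset.sum_congr rfl fun i _ => ?_
    rw [Nat.choose_succ_succ]
    push_cast
    ring
  · simp

theorem bonf_self (m : ℕ) (x : ℝ) : bonf m m x = (1 - x) ^ m := by
  rw [bonf_natCast, sub_eq_neg_add, add_pow]
  refine Finset.sum_congr rfl fun i _ => ?_
  rw [neg_pow x]
  ring

theorem sum_antidiagonal_choose_mul_bonf (N i : ℕ) (x : ℝ) :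
    ∑ a ∈ Finset.HasAntidiagonal.antidiagonal i, (N.choose a.1 : ℝ) * x ^ a.1 * bonf (N + a.2) (a.2 : ℕ) x
      = (1 - x) ^ i := by
  cases i with
  | zero => simp [bonf_zero_right]
  | succ i =>
    induction N with
    | zero =>
      rw [Finset.Nat.sum_antidiagonal_succ]
      simpa using bonf_self (i + 1) x
    | succ N ih =>
      have pascal : ∑ a ∈ Finset.HasAntidiagonal.antidiagonal (i + 1),
            ((N + 1).choose a.1 : ℝ) * x ^ a.1 * bonf (N + 1 + a.2) (a.2 : ℕ) x
          = ∑ a ∈ Finset.HasAntidiagonal.antidiagonal (i + 1),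
              (N.choose a.1 : ℝ) * x ^ a.1 * bonf (N + 1 + a.2) (a.2 : ℕ) x
            + ∑ a ∈ Finset.HasAntidiagonal.antidiagonal i,
              (N.choose a.1 : ℝ) * x ^ (a.1 + 1) * bonf (N + 1 + a.2) (a.2 : ℕ) x := by
        rw [Finset.Nat.sum_antidiagonal_succ, Finset.Nat.sum_antidiagonal_succ,
          add_assoc (_ * bonf _ _ _),
          ← Finset.sum_add_distrib]
        congr 1
        · simp
        · refine Finset.sum_congr rfl fun a _ => ?_
          rw [Nat.choose_succ_succ]
          push_cast
          ring
      rw [pascal, ← ih, Finset.Nat.sum_antidiagonal_succ', Finset.Nat.sum_antidiagonal_succ',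
        add_assoc, ← Finset.sum_add_distrib]
      congr 1
      · simp [bonf_zero_right]
      · refine Finset.sum_congr rfl fun a _ => ?_
        rw [show N + 1 + (a.2 + 1) = N + 1 + a.2 + 1 by ring, bonf_succ_succ,
          show N + (a.2 + 1) = N + 1 + a.2 by ring]
        ring

/-- the identity
`Σ_{j=0}^{i} C(n-k, i-j) (1-p)^{k-j} B(n-k+j, j, 1-p) = p^i (1-p)^{k-i}` for `0 ≤ i ≤ k ≤ n`. -/
theorem stmt9 (n k : ℕ) (hkn : k ≤ n) (p : ℝ) (i : ℕ) (hi : i ≤ k) :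
    ∑ j ∈ Finset.range (i + 1),
        ((n - k).choose (i - j) : ℝ) * (1 - p) ^ (k - j) * bonf (n - k + j) (j : ℤ) (1 - p)
      = p ^ i * (1 - p) ^ (k - i) := by
  have key := sum_antidiagonal_choose_mul_bonf (n - k) i (1 - p)
  rw [sub_sub_cancel, ← Finset.Nat.sum_antidiagonal_swap,
    Finset.Nat.sum_antidiagonal_eq_sum_range_succ_mk] at key
  rw [← key, Finset.sum_mul]
  refine Finset.sum_congr rfl fun j hj => ?_
  have hji : j ≤ i := Nat.lt_succ_iff.mp (Finset.mem_range.mp hj)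
  rw [show k - j = (i - j) + (k - i) by omega, pow_add]
  simp only [Prod.swap]
  ring
end
end
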